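/- A linear bijection Φ : ℝ^{2n+1} → ℝ^{2n+1} is an algebra automorphism of the Vidinli algebra, i.e. Φ(a ∗ b) = Φ(a) ∗ Φ(b) for all a, b, if and only if Φ(e₁) = e₁, Φ maps V₀ into V₀, and the restriction of Φ to V₀ preserves both the inner product and the symplectic form: Φ(u)·Φ(v) = u·v and ω(Φ(u), Φ(v)) = ω(u, v) for all u, v ∈ V₀. (In particular, Aut(V_{2n+1}) is the intersection O(2n) ∩ Sp(2n,ℝ) acting on V₀, i.e. a copy of the unitary group U(n).) -/

import Mathlib

noncomputable section

/-- Standard dot product on `ℝ^m`. -/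
def dot {m : ℕ} (a b : Fin m → ℝ) : ℝ := ∑ i, a i * b i

/-- The distinguished unit vector `e₁` of the Vidinli algebra (index `0`). -/
def e1 (n : ℕ) : Fin (2*n+1) → ℝ := fun i => if i.val = 0 then 1 else 0

/-- The standard symplectic form `ω` on `ℝ^{2n+1}` (vanishing on `e₁`):
`ω(a,b) = Σ_{k=1}^n (a_{2k} b_{2k+1} − a_{2k+1} b_{2k})` in the paper's 1-based indexing. -/
def omg (n : ℕ) (a b : Fin (2*n+1) → ℝ) : ℝ :=
  ∑ k : Fin n,
    (a ⟨2*k.val+1, by have := k.isLt; omega⟩ * b ⟨2*k.val+2, by have := k.isLt; omega⟩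
   - a ⟨2*k.val+2, by have := k.isLt; omega⟩ * b ⟨2*k.val+1, by have := k.isLt; omega⟩)

/-- The Vidinli multiplication on `ℝ^{2n+1}`. -/
def vprod (n : ℕ) (a b : Fin (2*n+1) → ℝ) : Fin (2*n+1) → ℝ :=
  dot a (e1 n) • b + dot b (e1 n) • a - dot a b • e1 n + omg n a b • e1 n

theorem dot_comm {m : ℕ} (a b : Fin m → ℝ) : dot a b = dot b a :=
  dotProduct_comm a b

theorem dot_add_left {m : ℕ} (a b c : Fin m → ℝ) : dot (a + b) c = dot a c + dot b c :=
  add_dotProduct a b c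

theorem dot_smul_left {m : ℕ} (r : ℝ) (a b : Fin m → ℝ) : dot (r • a) b = r * dot a b :=
  smul_dotProduct r a b

theorem dot_add_right {m : ℕ} (a b c : Fin m → ℝ) : dot a (b + c) = dot a b + dot a c :=
  dotProduct_add a b c

theorem dot_smul_right {m : ℕ} (r : ℝ) (a b : Fin m → ℝ) : dot a (r • b) = r * dot a b :=
  dotProduct_smul r a b

theorem dot_e1 (n : ℕ) (a : Fin (2*n+1) → ℝ) : dot a (e1 n) = a 0 := by
  simp [dot, e1]

theorem dot_e1_e1 (n : ℕ) : dot (e1 n) (e1 n) = 1 := by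
  simp [dot_e1, e1]

theorem omg_swap (n : ℕ) (a b : Fin (2*n+1) → ℝ) : omg n b a = -omg n a b := by
  simp only [omg, ← Finset.sum_neg_distrib]
  exact Finset.sum_congr rfl fun k _ => by ring

theorem omg_self (n : ℕ) (a : Fin (2*n+1) → ℝ) : omg n a a = 0 := by
  linarith [omg_swap n a a]

theorem omg_add_left (n : ℕ) (a b c : Fin (2*n+1) → ℝ) :
    omg n (a + b) c = omg n a c + omg n b c := by
  simp only [omg, ← Finset.sum_add_distrib, Pi.add_apply]
  exact Finset.sum_congr rfl fun k _ => by ring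

theorem omg_smul_left (n : ℕ) (r : ℝ) (a b : Fin (2*n+1) → ℝ) :
    omg n (r • a) b = r * omg n a b := by
  simp only [omg, Finset.mul_sum, Pi.smul_apply, smul_eq_mul]
  exact Finset.sum_congr rfl fun k _ => by ring

theorem omg_e1_left (n : ℕ) (a : Fin (2*n+1) → ℝ) : omg n (e1 n) a = 0 := by
  simp [omg, e1]

theorem omg_e1_right (n : ℕ) (a : Fin (2*n+1) → ℝ) : omg n a (e1 n) = 0 := by
  rw [omg_swap, omg_e1_left, neg_zero]

theorem omg_add_right (n : ℕ) (a b c : Fin (2*n+1) → ℝ) :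
    omg n a (b + c) = omg n a b + omg n a c := by
  rw [omg_swap, omg_add_left, omg_swap n a b, omg_swap n a c]
  ring

theorem omg_smul_right (n : ℕ) (r : ℝ) (a b : Fin (2*n+1) → ℝ) :
    omg n a (r • b) = r * omg n a b := by
  rw [omg_swap, omg_smul_left, omg_swap n a b]
  ring

theorem e1_vprod (n : ℕ) (a : Fin (2*n+1) → ℝ) : vprod n (e1 n) a = a := by
  simp [vprod, dot_e1_e1, omg_e1_left, dot_comm (e1 n) a]

theorem vprod_e1 (n : ℕ) (a : Fin (2*n+1) → ℝ) : vprod n a (e1 n) = a := by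
  simp [vprod, dot_e1_e1, omg_e1_right]

/-- The product of two vectors orthogonal to `e₁` is a multiple of `e₁`. -/
theorem vprod_of_orthogonal (n : ℕ) {u v : Fin (2*n+1) → ℝ}
    (hu : dot u (e1 n) = 0) (hv : dot v (e1 n) = 0) :
    vprod n u v = (omg n u v - dot u v) • e1 n := by
  rw [vprod, hu, hv]
  module

theorem smul_e1_injective (n : ℕ) : Function.Injective fun r : ℝ => r • e1 n := by
  intro r s h
  simpa [dot_smul_left, dot_e1_e1] using congrArg (fun x => dot x (e1 n)) h

theorem exists_eq_smul_e1_add (n : ℕ) (a : Fin (2*n+1) → ℝ) :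
    ∃ (r : ℝ) (u : Fin (2*n+1) → ℝ), dot u (e1 n) = 0 ∧ a = r • e1 n + u := by
  refine ⟨dot a (e1 n), a + (-dot a (e1 n)) • e1 n, ?_, by module⟩
  rw [dot_add_left, dot_smul_left, dot_e1_e1]
  ring

theorem vprod_smul_e1_add (n : ℕ) (r s : ℝ) {u v : Fin (2*n+1) → ℝ}
    (hu : dot u (e1 n) = 0) (hv : dot v (e1 n) = 0) :
    vprod n (r • e1 n + u) (s • e1 n + v) =
      (r * s + omg n u v - dot u v) • e1 n + r • v + s • u := by
  have hv' : dot (e1 n) v = 0 := by rw [dot_comm, hv]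
  simp only [vprod, dot_add_left, dot_smul_left, dot_add_right, dot_smul_right, dot_e1_e1,
    omg_add_left, omg_smul_left, omg_add_right, omg_smul_right, omg_e1_left, omg_e1_right,
    hu, hv, hv']
  module

/-- A linear bijection `Φ` of `ℝ^{2n+1}` is an automorphism of the
Vidinli algebra iff it fixes `e₁`, maps `V₀ = e₁^⊥` into itself, and its
restriction to `V₀` preserves both the inner product and the symplectic form. -/
theorem vidinli_automorphism_iff (n : ℕ) (hn : 1 ≤ n)
    (Φ : (Fin (2*n+1) → ℝ) ≃ₗ[ℝ] (Fin (2*n+1) → ℝ)) :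
    (∀ a b : Fin (2*n+1) → ℝ, Φ (vprod n a b) = vprod n (Φ a) (Φ b)) ↔
    (Φ (e1 n) = e1 n ∧
     (∀ u : Fin (2*n+1) → ℝ, dot u (e1 n) = 0 → dot (Φ u) (e1 n) = 0) ∧
     (∀ u v : Fin (2*n+1) → ℝ, dot u (e1 n) = 0 → dot v (e1 n) = 0 →
        dot (Φ u) (Φ v) = dot u v ∧ omg n (Φ u) (Φ v) = omg n u v)) := by
  constructor
  · intro h
    have h1 : Φ (e1 n) = e1 n := by
      have := h (e1 n) (Φ.symm (e1 n))
      rwa [e1_vprod, Φ.apply_symm_apply, vprod_e1, eq_comm] at this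
    have h2 : ∀ u, dot u (e1 n) = 0 → dot (Φ u) (e1 n) = 0 := by
      intro u hu
      by_contra hc
      have hsq := h u u
      rw [vprod_of_orthogonal n hu hu, map_smul, h1, vprod, omg_self, omg_self] at hsq
      set c := dot (Φ u) (e1 n)
      obtain ⟨t, ht⟩ : ∃ t : ℝ, Φ u = t • e1 n := by
        refine ⟨(2 * c)⁻¹ * (dot (Φ u) (Φ u) - dot u u), ?_⟩
        have h2c : (2 * c) • Φ u = (dot (Φ u) (Φ u) - dot u u) • e1 n := by
          linear_combination (norm := module) -hsq
        rw [mul_smul, ← h2c, inv_smul_smul₀ (mul_ne_zero two_ne_zero hc)]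
      have hut : u = t • e1 n := Φ.injective (by rw [ht, map_smul, h1])
      exact hc (by rw [← hu]; simp only [c]; rw [ht, ← hut])
    refine ⟨h1, h2, fun u v hu hv => ?_⟩
    have key : ∀ {u v}, dot u (e1 n) = 0 → dot v (e1 n) = 0 →
        omg n u v - dot u v = omg n (Φ u) (Φ v) - dot (Φ u) (Φ v) := by
      intro u v hu hv
      have huv := h u v
      rw [vprod_of_orthogonal n hu hv, vprod_of_orthogonal n (h2 u hu) (h2 v hv),
        map_smul, h1] at huv
      exact smul_e1_injective n huv
    have huv := key hu hv
    have hvu := key hv hu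
    rw [omg_swap n u v, omg_swap n (Φ u), dot_comm v, dot_comm (Φ v)] at hvu
    constructor <;> linarith
  · rintro ⟨h1, h2, h3⟩ a b
    obtain ⟨r, u, hu, rfl⟩ := exists_eq_smul_e1_add n a
    obtain ⟨s, v, hv, rfl⟩ := exists_eq_smul_e1_add n b
    obtain ⟨hdot, homg⟩ := h3 u v hu hv
    simp only [vprod_smul_e1_add n r s hu hv, map_add, map_smul, h1,
      vprod_smul_e1_add n r s (h2 u hu) (h2 v hv), hdot, homg]
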